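/- arXiv:2401.08800 — 2 statements merged into one kernel-verified Lean document; each statement's English description precedes it below -/
import Mathlib

section
/- W acts transitively on the set of 10-element cliques in C with weights in {1,2} whose weight-2 graph is a disjoint union of two triangles and two single edges (i.e., two 3-cycles and two disjoint edges covering 3+3+2+2 = 10 vertices). -/
/-- The intersection pairing on `ℤ⁹`, the Picard lattice of a del Pezzo surface of degree 1. -/
def B (v w : Fin 9 → ℤ) : ℤ := v 0 * w 0 - ∑ i : Fin 8, v i.succ * w i.succ

/-- The canonical class `K = (-3, -1, …, -1)`. -/
def Kcl : Fin 9 → ℤ := fun i => if i = 0 then -3 else -1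

/-- A vector is an exceptional class if `B(v,v) = -1` and `B(v,K) = -1`. -/
def IsExc (v : Fin 9 → ℤ) : Prop := B v v = -1 ∧ B v Kcl = -1

/-- The type of exceptional classes (the set `C`). -/
abbrev Exc : Type := {v : Fin 9 → ℤ // IsExc v}

/-- The pairing on exceptional classes. -/
def Bx (x y : Exc) : ℤ := B x.1 y.1

/-- `S` is a clique with weights in `M` if `B(x,y) ∈ M` for all distinct `x, y ∈ S`. -/
def IsClique (M : Set ℤ) (S : Finset Exc) : Prop :=
  ∀ x ∈ S, ∀ y ∈ S, x ≠ y → Bx x y ∈ M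

/-- A bijection of `C` preserving the pairing `B`: an element of the Weyl group `W`. -/
def PreservesB (g : Exc ≃ Exc) : Prop := ∀ x y : Exc, Bx (g x) (g y) = Bx x y

/-- Two finite subsets of `C` lie in the same orbit of `W`. -/
def SameOrbit (S T : Finset Exc) : Prop :=
  ∃ g : Exc ≃ Exc, PreservesB g ∧ S.image g = T

/-- The weight-2 graph of the clique `S` is (isomorphic to) the graph on `Fin 10` in which
`i ≠ j` are adjacent iff `p i j`: there is a bijection `σ : Fin 10 ≃ S` such that for all
`i ≠ j`, `B(σ i, σ j) = 2` holds iff `p i j` holds. -/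
def HasWeight2Graph (p : Fin 10 → Fin 10 → Prop) (S : Finset Exc) : Prop :=
  ∃ σ : Fin 10 ≃ {x // x ∈ S}, ∀ i j : Fin 10, i ≠ j → (Bx (σ i).1 (σ j).1 = 2 ↔ p i j)

/-- Block structure of a disjoint union of two triangles (`{0,1,2}`, `{3,4,5}`) and
two single edges (`{6,7}`, `{8,9}`). -/
def blockTTEE (i : Fin 10) : ℕ :=
  if i.1 < 3 then 0 else if i.1 < 6 then 1 else if i.1 < 8 then 2 else 3

lemma B_add_left (u v w : Fin 9 → ℤ) : B (u + v) w = B u w + B v w := by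
  simp only [B, Fin.sum_univ_eight, Pi.add_apply]; ring
lemma B_sub_left (u v w : Fin 9 → ℤ) : B (u - v) w = B u w - B v w := by
  simp only [B, Fin.sum_univ_eight, Pi.sub_apply]; ring
lemma B_smul_left (c : ℤ) (v w : Fin 9 → ℤ) : B (c • v) w = c * B v w := by
  simp only [B, Fin.sum_univ_eight, Pi.smul_apply, smul_eq_mul]; ring
lemma B_comm (v w : Fin 9 → ℤ) : B v w = B w v := by
  simp only [B, Fin.sum_univ_eight]; ring
lemma B_add_right (u v w : Fin 9 → ℤ) : B w (u + v) = B w u + B w v := by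
  rw [B_comm, B_add_left, B_comm u, B_comm v]
lemma B_sub_right (u v w : Fin 9 → ℤ) : B w (u - v) = B w u - B w v := by
  rw [B_comm, B_sub_left, B_comm u, B_comm v]
lemma B_smul_right (c : ℤ) (v w : Fin 9 → ℤ) : B w (c • v) = c * B w v := by
  rw [B_comm, B_smul_left, B_comm v]
lemma B_KK : B Kcl Kcl = 1 := by decide
lemma B_sum_left {ι : Type*} (t : Finset ι) (f : ι → Fin 9 → ℤ) (w : Fin 9 → ℤ) :
    B (∑ i ∈ t, f i) w = ∑ i ∈ t, B (f i) w := by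
  classical
  induction t using Finset.induction_on with
  | empty => simp [B]
  | insert a t ha ih => rw [Finset.sum_insert ha, Finset.sum_insert ha, B_add_left, ih]

lemma B_dvd (v w : Fin 9 → ℤ) (h : ∀ k, (3 : ℤ) ∣ v k) : (3 : ℤ) ∣ B v w := by
  choose u hu using h
  have : v = (3 : ℤ) • u := by ext k; simp [hu]
  rw [this, B_smul_left]; exact Dvd.intro _ rfl

/-- definiteness on the complement of K -/
lemma B_def (v : Fin 9 → ℤ) (h0 : B v v = 0) (hK : B v Kcl = 0) : v = 0 := by
  have h1 : (∑ i : Fin 8, v i.succ) = 3 * v 0 := by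
    have : B v Kcl = -3 * v 0 + ∑ i : Fin 8, v i.succ := by
      simp [B, Kcl, Fin.succ_ne_zero]; ring
    linarith
  have h2 : (∑ i : Fin 8, v i.succ ^ 2) = v 0 ^ 2 := by
    have : B v v = v 0 ^ 2 - ∑ i : Fin 8, v i.succ ^ 2 := by
      simp [B, pow_two]
    linarith
  have h3 := sq_sum_le_card_mul_sum_sq (s := (Finset.univ : Finset (Fin 8))) (f := fun i => v i.succ)
  rw [h1, h2] at h3
  simp at h3
  have h4 : v 0 = 0 := by nlinarith [sq_nonneg (v 0)]
  rw [h4] at h2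
  have h5 := (Finset.sum_eq_zero_iff_of_nonneg (fun i _ => sq_nonneg (v (Fin.succ i)))).1 (by simpa using h2)
  funext k
  refine Fin.cases h4 (fun i => ?_) k
  simpa using h5 i (Finset.mem_univ _)

/-- the diagonal form -/
def Jm : Matrix (Fin 9) (Fin 9) ℤ := Matrix.diagonal (fun i => if i = 0 then 1 else -1)

lemma mul_J (ι κ : Type*) (P : Matrix ι (Fin 9) ℤ) (Q : Matrix κ (Fin 9) ℤ) (i : ι) (j : κ) :
    (P * Jm * Q.transpose) i j = B (P i) (Q j) := by
  rw [Matrix.mul_apply]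
  simp only [Jm, Matrix.mul_diagonal, Matrix.transpose_apply, B, Fin.sum_univ_succ (n := 8)]
  simp [Fin.succ_ne_zero, sub_eq_add_neg]

lemma rel3 (a : Fin 4 → Fin 9 → ℤ) (d : Fin 3 → Fin 9 → ℤ)
    (haa : ∀ i j, B (a i) (a j) = if i = j then -2 else 0)
    (haK : ∀ i, B (a i) Kcl = 0) (hdK : ∀ i, B (d i) Kcl = 0)
    (hdd : ∀ i j, (3 : ℤ) ∣ B (d i) (d j)) (hda : ∀ i j, (3 : ℤ) ∣ B (d i) (a j)) :
    ∃ c : Fin 3 → ℤ, (∃ i, ¬ (3 : ℤ) ∣ c i) ∧ ∀ k, (3 : ℤ) ∣ ∑ i, c i * d i k := by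
  by_contra hcon
  push Not at hcon
  have : Fact (Nat.Prime 3) := ⟨by norm_num⟩
  let Pz : Matrix (Unit ⊕ Fin 4 ⊕ Fin 3) (Fin 9) ℤ := Sum.elim (fun _ => Kcl) (Sum.elim a d)
  let f := Int.castRingHom (ZMod 3)
  have hf : ∀ z : ℤ, f z = 0 ↔ (3 : ℤ) ∣ z := fun z => ZMod.intCast_zmod_eq_zero_iff_dvd z 3
  have hsurj : ∀ x : ZMod 3, ∃ z : ℤ, f z = x := fun x => ⟨x.val, by simp [f]⟩
  let D : Matrix (Fin 3) (Fin 9) (ZMod 3) := Matrix.map d f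
  let P := Pz.map f
  have hD : LinearIndependent (ZMod 3) D.row := by
    rw [Fintype.linearIndependent_iff]
    intro g hg i
    choose z hz using fun i => hsurj (g i)
    by_contra hi
    obtain ⟨k, hk⟩ := hcon z ⟨i, by rw [← hf, hz]; exact hi⟩
    apply hk
    rw [← hf, map_sum]
    simp only [map_mul, hz]
    have := congrFun hg k
    rw [Finset.sum_apply] at this
    exact this
  have hP : LinearIndependent (ZMod 3) P.row := by
    rw [Fintype.linearIndependent_iff]
    intro g hg
    choose z hz using fun i => hsurj (g i)
    have hv : ∀ k, (3 : ℤ) ∣ (∑ i, z i • Pz i) k := by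
      intro k
      rw [← hf, Finset.sum_apply, map_sum]
      simp only [Pi.smul_apply, smul_eq_mul, map_mul, hz]
      have := congrFun hg k
      rw [Finset.sum_apply] at this
      exact this
    have hK : (3 : ℤ) ∣ z (Sum.inl ()) := by
      have := B_dvd _ Kcl hv
      rw [B_sum_left] at this
      simp only [B_smul_left, Pz, Fintype.sum_sum_type, Sum.elim_inl, Sum.elim_inr, haK, hdK,
        B_KK] at this
      simpa using this
    have hA : ∀ j, (3 : ℤ) ∣ z (Sum.inr (Sum.inl j)) := by
      intro j
      have := B_dvd _ (a j) hv
      rw [B_sum_left] at this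
      simp only [B_smul_left, Pz, Fintype.sum_sum_type, Sum.elim_inl, Sum.elim_inr, haa,
        B_comm Kcl, haK] at this
      simp at this
      have h2 : (3 : ℤ) ∣ ∑ x : Fin 3, z (Sum.inr (Sum.inr x)) * B (d x) (a j) :=
        Finset.dvd_sum fun x _ => Dvd.dvd.mul_left (hda x j) _
      omega
    have hA' : ∀ j, g (Sum.inr (Sum.inl j)) = 0 := fun j => by rw [← hz, hf]; exact hA j
    have hK' : g (Sum.inl ()) = 0 := by rw [← hz, hf]; exact hK
    have hD' := Fintype.linearIndependent_iff.1 hD (fun i => g (Sum.inr (Sum.inr i))) (by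
      rw [Fintype.sum_sum_type, Fintype.sum_sum_type] at hg
      simp only [hA', Finset.univ_unique, Finset.sum_singleton] at hg
      have : g (Sum.inl default) = 0 := hK'
      rw [this] at hg
      simp only [zero_smul, Finset.sum_const_zero, zero_add] at hg
      exact hg)
    rintro (i | i | i)
    · exact hK'
    · exact hA' i
    · exact hD' i
  have h0 : (P * Jm.map f) * D.transpose = 0 := by
    have : (P * Jm.map f) * D.transpose = (Pz * Jm * Matrix.transpose (Matrix.of d)).map f := by
      rw [Matrix.map_mul, Matrix.map_mul]; rfl
    rw [this]
    ext i j
    rw [Matrix.map_apply, mul_J, Matrix.zero_apply, hf]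
    show (3 : ℤ) ∣ B (Pz i) (d j)
    rcases i with i | i | i
    · simp [Pz, B_comm Kcl, hdK]
    · simp only [Pz, Sum.elim_inr, Sum.elim_inl]; rw [B_comm]; exact hda j i
    · exact hdd i j
  have hr := Matrix.rank_add_rank_le_card_of_mul_eq_zero h0
  have hJ : IsUnit (Jm.map f).det := by
    have : (Jm.map f).det = f Jm.det := by rw [RingHom.map_det]; rfl
    rw [this]
    apply IsUnit.map
    rw [Jm, Matrix.det_diagonal]
    decide
  rw [Matrix.rank_mul_eq_left_of_isUnit_det _ _ hJ, Matrix.rank_transpose, hP.rank_matrix, hD.rank_matrix] at hr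
  simp at hr

def GV : Matrix (Fin 9) (Fin 9) ℤ :=
  !![1, -1, -1, -1, -1, -1, -1, -1, -1;
    -1, -1, 2, 1, 1, 1, 1, 1, 1;
    -1, 2, -1, 1, 1, 1, 1, 1, 1;
    -1, 1, 1, -1, 2, 1, 1, 1, 1;
    -1, 1, 1, 2, -1, 1, 1, 1, 1;
    -1, 1, 1, 1, 1, -1, 2, 1, 1;
    -1, 1, 1, 1, 1, 2, -1, 1, 1;
    -1, 1, 1, 1, 1, 1, 1, -1, 2;
    -1, 1, 1, 1, 1, 1, 1, 2, -1]

def Tm : Matrix (Fin 9) (Fin 9) ℤ :=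
  !![3, 0, 0, 0, 0, 0, 0, 0, 0;
    0, 1, -1, 1, -1, 1, -1, 0, 0;
    0, 0, 0, 1, -1, -1, 1, 1, -1;
    0, 3, 0, 0, 0, 0, 0, 0, 0;
    0, 0, 0, 0, 0, 0, 0, 3, 0;
    0, 0, 0, 3, 0, 0, 0, 0, 0;
    0, 0, 0, 0, 3, 0, 0, 0, 0;
    0, 0, 0, 0, 0, 3, 0, 0, 0;
    0, 0, 0, 0, 0, 0, 3, 0, 0]

def G0 : Matrix (Fin 9) (Fin 9) ℤ :=
  !![1, 0, 0, -1, -1, -1, -1, -1, -1;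
    0, -2, 0, -1, 0, -1, 1, -1, 1;
    0, 0, -2, 0, -1, -1, 1, 1, -1;
    -1, -1, 0, -1, 1, 1, 1, 1, 1;
    -1, 0, -1, 1, -1, 1, 1, 1, 1;
    -1, -1, -1, 1, 1, -1, 2, 1, 1;
    -1, 1, 1, 1, 1, 2, -1, 1, 1;
    -1, -1, 1, 1, 1, 1, 1, -1, 2;
    -1, 1, -1, 1, 1, 1, 1, 2, -1]

def Gi : Matrix (Fin 9) (Fin 9) ℤ :=
  !![-7, 3, 3, -2, -2, -3, 1, -1, -1;
    3, -6, 0, 3, 0, 2, -2, 2, -2;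
    3, 0, -6, 0, 3, 2, -2, -2, 2;
    -2, 3, 0, -2, 0, -1, 1, -1, 1;
    -2, 0, 3, 0, -2, -1, 1, 1, -1;
    -3, 2, 2, -1, -1, -2, 1, 0, 0;
    1, -2, -2, 1, 1, 1, -2, 0, 0;
    -1, 2, -2, -1, 1, 0, 0, -2, 1;
    -1, -2, 2, 1, -1, 0, 0, 1, -2]

def Cm : Matrix (Fin 9) (Fin 9) ℤ :=
  !![1, 0, 0, 0, 0, 0, 0, 0, 0;
    0, 0, 0, 1, 0, 0, 0, 0, 0;
    0, -3, 0, 1, 0, 1, -1, 1, -1;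
    0, 0, 0, 0, 0, 1, 0, 0, 0;
    0, 0, 0, 0, 0, 0, 1, 0, 0;
    0, 0, 0, 0, 0, 0, 0, 1, 0;
    0, 0, 0, 0, 0, 0, 0, 0, 1;
    0, 0, 0, 0, 1, 0, 0, 0, 0;
    0, 0, -3, 0, 1, 1, -1, -1, 1]

lemma T_GV : Tm * GV * Tm.transpose = (9 : ℤ) • G0 := by decide +kernel
lemma G0_Gi : G0 * Gi = 1 := by decide +kernel
lemma C_T : Cm * Tm = (3 : ℤ) • 1 := by decide +kernel

/-- the Gram condition -/
def Gr (s : Fin 10 → Exc) : Prop :=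
  ∀ i j, Bx (s i) (s j) = if i = j then -1 else if blockTTEE i = blockTTEE j then 2 else 1

def dd (s : Fin 10 → Exc) (j : Fin 4) : Fin 9 → ℤ :=
  (s (![0, 3, 6, 8] j)).1 - (s (![1, 4, 7, 9] j)).1

def Glue (s : Fin 10 → Exc) : Prop :=
  (∀ k, (3 : ℤ) ∣ dd s 0 k + dd s 1 k + dd s 2 k) ∧
  (∀ k, (3 : ℤ) ∣ dd s 3 k + dd s 1 k - dd s 2 k)

def Vm (s : Fin 10 → Exc) : Matrix (Fin 9) (Fin 9) ℤ :=
  Matrix.of (Fin.cons Kcl fun i : Fin 8 => (s (![0, 1, 3, 4, 6, 7, 8, 9] i)).1)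

lemma Gr.V {s : Fin 10 → Exc} (h : Gr s) : Vm s * Jm * (Vm s).transpose = GV := by
  ext i j
  rw [mul_J]
  have hK : ∀ i, B (s i).1 Kcl = -1 := fun i => (s i).2.2
  have hK' : ∀ i, B Kcl (s i).1 = -1 := fun i => by rw [B_comm]; exact hK i
  have h' : ∀ i j, B (s i).1 (s j).1 = _ := h
  refine Fin.cases ?_ (fun i => ?_) i <;> refine Fin.cases ?_ (fun j => ?_) j
  · exact B_KK
  · show B Kcl (s _).1 = _
    rw [hK']; revert j; decide
  · show B (s _).1 Kcl = _
    rw [hK]; revert i; decide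
  · show B (s _).1 (s _).1 = _
    rw [h']; revert i j; decide

lemma exists_W {s : Fin 10 → Exc} (h : Gr s) (hg : Glue s) :
    ∃ W : Matrix (Fin 9) (Fin 9) ℤ, W * Jm * W.transpose = G0 ∧ Vm s = Cm * W := by
  have h3 : ∀ i k, (3 : ℤ) ∣ (Tm * Vm s) i k := by
    intro i k
    have h1 := hg.1 k
    have h2 := hg.2 k
    simp only [dd, Pi.sub_apply] at h1 h2
    have v1 : Vm s 1 k = (s 0).1 k := rfl
    have v2 : Vm s 2 k = (s 1).1 k := rfl
    have v3 : Vm s 3 k = (s 3).1 k := rfl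
    have v4 : Vm s 4 k = (s 4).1 k := rfl
    have v5 : Vm s 5 k = (s 6).1 k := rfl
    have v6 : Vm s 6 k = (s 7).1 k := rfl
    have v7 : Vm s 7 k = (s 8).1 k := rfl
    have v8 : Vm s 8 k = (s 9).1 k := rfl
    rw [Matrix.mul_apply]
    simp only [Fin.sum_univ_succ]
    fin_cases i <;> simp [Tm, v1, v2, v3, v4, v5, v6, v7, v8] at h1 h2 ⊢ <;> omega
  choose W hW using h3
  have hW' : Tm * Vm s = (3 : ℤ) • Matrix.of W := by
    ext i k; simp [hW]
  refine ⟨Matrix.of W, ?_, ?_⟩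
  · have : (9 : ℤ) • (Matrix.of W * Jm * (Matrix.of W).transpose) = (9 : ℤ) • G0 := by
      rw [← T_GV, ← h.V]
      have : Tm * (Vm s * Jm * (Vm s).transpose) * Tm.transpose
          = (Tm * Vm s) * Jm * (Tm * Vm s).transpose := by
        rw [Matrix.transpose_mul]; simp only [Matrix.mul_assoc]
      rw [this, hW', Matrix.transpose_smul]
      simp only [Matrix.smul_mul, Matrix.mul_smul, smul_smul]
      norm_num
    exact smul_right_injective _ (by norm_num : (9 : ℤ) ≠ 0) this
  · have : (3 : ℤ) • Vm s = (3 : ℤ) • (Cm * Matrix.of W) := by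
      rw [← Matrix.mul_smul, ← hW', ← Matrix.mul_assoc, C_T, Matrix.smul_mul, Matrix.one_mul]
    exact smul_right_injective _ (by norm_num : (3 : ℤ) ≠ 0) this

lemma exists_A {s t : Fin 10 → Exc} (hs : Gr s) (ht : Gr t) (gs : Glue s) (gt : Glue t) :
    ∃ A A' : Matrix (Fin 9) (Fin 9) ℤ, A * A' = 1 ∧ A' * A = 1 ∧
      A * Jm * A.transpose = Jm ∧ Vm s * A = Vm t := by
  obtain ⟨W, hW, hV⟩ := exists_W hs gs
  obtain ⟨W', hW', hV'⟩ := exists_W ht gt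
  have inv : ∀ X : Matrix (Fin 9) (Fin 9) ℤ, X * Jm * X.transpose = G0 →
      ∃ Y, X * Y = 1 ∧ Y * X = 1 := by
    intro X hX
    have : X * (Jm * X.transpose * Gi) = 1 := by
      rw [← G0_Gi, ← hX]; simp only [Matrix.mul_assoc]
    exact ⟨_, this, mul_eq_one_comm.1 this⟩
  obtain ⟨Y, hY, hY2⟩ := inv W hW
  obtain ⟨Y', hY', hY2'⟩ := inv W' hW'
  refine ⟨Y * W', Y' * W, ?_, ?_, ?_, ?_⟩
  · rw [Matrix.mul_assoc, ← Matrix.mul_assoc W', hY', Matrix.one_mul, hY2]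
  · rw [Matrix.mul_assoc, ← Matrix.mul_assoc W, hY, Matrix.one_mul, hY2']
  · have : Y * W' * Jm * (Y * W').transpose = Y * (W' * Jm * W'.transpose) * Y.transpose := by
      rw [Matrix.transpose_mul]; simp only [Matrix.mul_assoc]
    rw [this, hW', ← hW]
    have : Y * (W * Jm * W.transpose) * Y.transpose = (Y * W) * Jm * (Y * W).transpose := by
      rw [Matrix.transpose_mul]; simp only [Matrix.mul_assoc]
    rw [this, hY2]; simp
  · rw [hV, hV', Matrix.mul_assoc, ← Matrix.mul_assoc W, hY, Matrix.one_mul]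

lemma B_vecMul {A : Matrix (Fin 9) (Fin 9) ℤ} (hA : A * Jm * A.transpose = Jm)
    (v w : Fin 9 → ℤ) : B (Matrix.vecMul v A) (Matrix.vecMul w A) = B v w := by
  let P : Matrix Unit (Fin 9) ℤ := fun _ => v
  let Q : Matrix Unit (Fin 9) ℤ := fun _ => w
  have h1 := mul_J _ _ (P * A) (Q * A) () ()
  have h2 := mul_J _ _ P Q () ()
  have : P * A * Jm * (Q * A).transpose = P * Jm * Q.transpose := by
    have : P * A * Jm * (Q * A).transpose = P * (A * Jm * A.transpose) * Q.transpose := by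
      rw [Matrix.transpose_mul]; simp only [Matrix.mul_assoc]
    rw [this, hA]
  rw [this, h2] at h1
  exact h1.symm

lemma Gr.tri {s : Fin 10 → Exc} (h : Gr s) (i j k : Fin 10) (hij : i ≠ j) (hjk : j ≠ k)
    (hik : i ≠ k) (b1 : blockTTEE i = blockTTEE j) (b2 : blockTTEE i = blockTTEE k) :
    (s k).1 = (-3 : ℤ) • Kcl - (s i).1 - (s j).1 := by
  have hK : ∀ i, B (s i).1 Kcl = -1 := fun i => (s i).2.2
  have hK' : ∀ i, B Kcl (s i).1 = -1 := fun i => by rw [B_comm]; exact hK i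
  have h' : ∀ i j, B (s i).1 (s j).1 = _ := h
  have := B_def ((s k).1 - ((-3 : ℤ) • Kcl - (s i).1 - (s j).1)) (by
    simp only [B_sub_left, B_sub_right, B_smul_left, B_smul_right, hK, hK', B_KK, h']
    simp [hij, hjk, hik, hij.symm, hjk.symm, hik.symm, ← b1, ← b2]) (by
    simp only [B_sub_left, B_smul_left, hK, B_KK]; norm_num)
  exact sub_eq_zero.1 this

lemma orbit_of {s t : Fin 10 → Exc} (hs : Gr s) (ht : Gr t) (gs : Glue s) (gt : Glue t) :
    ∃ g : Exc ≃ Exc, PreservesB g ∧ ∀ i, g (s i) = t i := by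
  obtain ⟨A, A', h1, h2, hJ, hV⟩ := exists_A hs ht gs gt
  have hJ' : A' * Jm * A'.transpose = Jm := by
    have : A' * (A * Jm * A.transpose) * A'.transpose = (A' * A) * Jm * (A' * A).transpose := by
      rw [Matrix.transpose_mul]; simp only [Matrix.mul_assoc]
    rw [hJ, h2] at this
    simpa using this
  have row : ∀ i, Matrix.vecMul (Vm s i) A = Vm t i := fun i => by
    rw [← hV]; rfl
  have hK : Matrix.vecMul Kcl A = Kcl := row 0
  have hK' : Matrix.vecMul Kcl A' = Kcl := by
    conv_lhs => rw [← hK]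
    rw [Matrix.vecMul_vecMul, h1, Matrix.vecMul_one]
  have ex : ∀ M : Matrix (Fin 9) (Fin 9) ℤ, M * Jm * M.transpose = Jm →
      Matrix.vecMul Kcl M = Kcl → ∀ v, IsExc v → IsExc (Matrix.vecMul v M) := by
    intro M hM hKM v hv
    refine ⟨by rw [B_vecMul hM]; exact hv.1, ?_⟩
    have := B_vecMul hM v Kcl
    rw [hKM] at this
    rw [this]; exact hv.2
  refine ⟨⟨fun x => ⟨_, ex A hJ hK x.1 x.2⟩, fun x => ⟨_, ex A' hJ' hK' x.1 x.2⟩, ?_, ?_⟩, ?_, ?_⟩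
  · intro x; apply Subtype.ext; simp [Matrix.vecMul_vecMul, h1]
  · intro x; apply Subtype.ext; simp [Matrix.vecMul_vecMul, h2]
  · intro x y; exact B_vecMul hJ _ _
  · intro i
    apply Subtype.ext
    show Matrix.vecMul (s i).1 A = (t i).1
    have e0 : Matrix.vecMul (s 0).1 A = (t 0).1 := row 1
    have e1 : Matrix.vecMul (s 1).1 A = (t 1).1 := row 2
    have e3 : Matrix.vecMul (s 3).1 A = (t 3).1 := row 3
    have e4 : Matrix.vecMul (s 4).1 A = (t 4).1 := row 4
    have e6 : Matrix.vecMul (s 6).1 A = (t 6).1 := row 5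
    have e7 : Matrix.vecMul (s 7).1 A = (t 7).1 := row 6
    have e8 : Matrix.vecMul (s 8).1 A = (t 8).1 := row 7
    have e9 : Matrix.vecMul (s 9).1 A = (t 9).1 := row 8
    have e2 : Matrix.vecMul (s 2).1 A = (t 2).1 := by
      rw [hs.tri 0 1 2 (by decide) (by decide) (by decide) (by decide) (by decide),
        ht.tri 0 1 2 (by decide) (by decide) (by decide) (by decide) (by decide),
        Matrix.sub_vecMul, Matrix.sub_vecMul, Matrix.smul_vecMul, hK, e0, e1]
    have e5 : Matrix.vecMul (s 5).1 A = (t 5).1 := by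
      rw [hs.tri 3 4 5 (by decide) (by decide) (by decide) (by decide) (by decide),
        ht.tri 3 4 5 (by decide) (by decide) (by decide) (by decide) (by decide),
        Matrix.sub_vecMul, Matrix.sub_vecMul, Matrix.smul_vecMul, hK, e3, e4]
    fin_cases i <;> assumption

lemma signs (a : Fin 4 → Fin 9 → ℤ) (d : Fin 3 → Fin 9 → ℤ)
    (haa : ∀ i j, B (a i) (a j) = if i = j then -2 else 0)
    (haK : ∀ i, B (a i) Kcl = 0) (hdK : ∀ i, B (d i) Kcl = 0)
    (hdd : ∀ i j, B (d i) (d j) = if i = j then -6 else 0)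
    (hda : ∀ i j, (3 : ℤ) ∣ B (d i) (a j)) :
    ∃ p q : ℤ, (p = 1 ∨ p = -1) ∧ (q = 1 ∨ q = -1) ∧
      ∀ k, (3 : ℤ) ∣ d 0 k + p * d 1 k + q * d 2 k := by
  obtain ⟨c, ⟨i, hi⟩, hc⟩ := rel3 a d haa haK hdK
    (fun i j => by rw [hdd]; split_ifs <;> norm_num) hda
  choose u hu using hc
  have e : c 0 • d 0 + c 1 • d 1 + c 2 • d 2 = (3 : ℤ) • u := by
    ext k
    have := hu k
    rw [Fin.sum_univ_three] at this
    simpa using this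
  have n : -6 * (c 0 ^ 2 + c 1 ^ 2 + c 2 ^ 2) = 9 * B u u := by
    have : B (c 0 • d 0 + c 1 • d 1 + c 2 • d 2) (c 0 • d 0 + c 1 • d 1 + c 2 • d 2)
        = B ((3 : ℤ) • u) ((3 : ℤ) • u) := by rw [e]
    simp only [B_add_left, B_add_right, B_smul_left, B_smul_right, hdd] at this
    simp at this
    linarith
  have sq : ∀ x : ℤ, (3 ∣ x ∧ x ^ 2 % 3 = 0) ∨ (x % 3 = 1 ∧ x ^ 2 % 3 = 1) ∨
      (x % 3 = 2 ∧ x ^ 2 % 3 = 1) := by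
    intro x
    have : x % 3 = 0 ∨ x % 3 = 1 ∨ x % 3 = 2 := by omega
    rcases this with h | h | h <;> simp [pow_two, Int.mul_emod, h] <;> omega
  have nz : ¬ (3 : ℤ) ∣ c 0 ∧ ¬ (3 : ℤ) ∣ c 1 ∧ ¬ (3 : ℤ) ∣ c 2 := by
    have s0 := sq (c 0)
    have s1 := sq (c 1)
    have s2 := sq (c 2)
    fin_cases i <;> simp at hi <;> omega
  have pm : ∀ x y : ℤ, ¬ 3 ∣ x → ¬ 3 ∣ y → ∃ p : ℤ, (p = 1 ∨ p = -1) ∧ 3 ∣ y - p * x := by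
    intro x y hx hy
    by_cases h : 3 ∣ y - x
    · exact ⟨1, by simp, by simpa using h⟩
    · refine ⟨-1, by simp, ?_⟩
      have h1 : x % 3 = 1 ∨ x % 3 = 2 := by omega
      have h2 : y % 3 = 1 ∨ y % 3 = 2 := by omega
      rcases h1 with h1 | h1 <;> rcases h2 with h2 | h2 <;> omega
  obtain ⟨p, hp, hp'⟩ := pm (c 0) (c 1) nz.1 nz.2.1
  obtain ⟨q, hq, hq'⟩ := pm (c 0) (c 2) nz.1 nz.2.2
  refine ⟨p, q, hp, hq, fun k => ?_⟩
  have : (3 : ℤ) ∣ c 0 * (d 0 k + p * d 1 k + q * d 2 k) := by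
    have h := hu k
    rw [Fin.sum_univ_three] at h
    have : c 0 * (d 0 k + p * d 1 k + q * d 2 k)
        = 3 * u k - (c 1 - p * c 0) * d 1 k - (c 2 - q * c 0) * d 2 k := by
      rw [← h]; ring
    rw [this]
    exact dvd_sub (dvd_sub (Dvd.intro _ rfl) (hp'.mul_right _)) (hq'.mul_right _)
  exact (Int.prime_three.dvd_or_dvd this).resolve_left nz.1

lemma Gr.dd {s : Fin 10 → Exc} (h : Gr s) (i j : Fin 4) :
    B (dd s i) (dd s j) = if i = j then -6 else 0 := by
  have h' : ∀ i j, B (s i).1 (s j).1 = _ := h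
  simp only [_root_.dd, B_sub_left, B_sub_right, h']
  revert i j; decide

lemma Gr.signs {s : Fin 10 → Exc} (h : Gr s) (e : Fin 3 → Fin 4) (he : Function.Injective e) :
    ∃ p q : ℤ, (p = 1 ∨ p = -1) ∧ (q = 1 ∨ q = -1) ∧
      ∀ k, (3 : ℤ) ∣ _root_.dd s (e 0) k + p * _root_.dd s (e 1) k + q * _root_.dd s (e 2) k := by
  have hK : ∀ i, B (s i).1 Kcl = -1 := fun i => (s i).2.2
  have hK' : ∀ i, B Kcl (s i).1 = -1 := fun i => by rw [B_comm]; exact hK i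
  have h' : ∀ i j, B (s i).1 (s j).1 = _ := h
  refine _root_.signs (fun i => (s (![0, 3, 6, 8] i)).1 + Kcl) (fun i => _root_.dd s (e i)) ?_ ?_ ?_ ?_ ?_
  · intro i j
    simp only [B_add_left, B_add_right, hK, hK', h', B_KK]
    revert i j; decide
  · intro i; simp only [B_add_left, hK, B_KK]; norm_num
  · intro i; simp only [_root_.dd, B_sub_left, hK]; norm_num
  · intro i j; rw [h.dd]; simp [he.eq_iff]
  · intro i j
    simp only [_root_.dd, B_add_right, B_sub_left, hK, h']
    generalize e i = i'
    revert i' j; decide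

lemma Gr.perm {s : Fin 10 → Exc} (h : Gr s) (π : Equiv.Perm (Fin 10))
    (hπ : ∀ i, blockTTEE (π i) = blockTTEE i) : Gr (s ∘ π) := by
  intro i j
  simp only [Function.comp, h (π i) (π j), hπ, π.injective.eq_iff]

/-- flips -/
def flip3 (x y z : Bool) : Equiv.Perm (Fin 10) :=
  (if x then Equiv.swap 3 4 else 1) * (if y then Equiv.swap 6 7 else 1) *
    (if z then Equiv.swap 8 9 else 1)

lemma flip3_block : ∀ x y z i, blockTTEE (flip3 x y z i) = blockTTEE i := by decide

lemma flip3_dd (s : Fin 10 → Exc) (x y z : Bool) :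
    dd (s ∘ flip3 x y z) 0 = dd s 0 ∧
    dd (s ∘ flip3 x y z) 1 = (if x then (-1 : ℤ) else 1) • dd s 1 ∧
    dd (s ∘ flip3 x y z) 2 = (if y then (-1 : ℤ) else 1) • dd s 2 ∧
    dd (s ∘ flip3 x y z) 3 = (if z then (-1 : ℤ) else 1) • dd s 3 := by
  have e0 : ∀ x y z, flip3 x y z 0 = 0 ∧ flip3 x y z 1 = 1 := by decide
  have e1 : ∀ x y z, flip3 x y z 3 = (if x then 4 else 3) ∧
    flip3 x y z 4 = (if x then 3 else 4) := by decide
  have e2 : ∀ x y z, flip3 x y z 6 = (if y then 7 else 6) ∧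
    flip3 x y z 7 = (if y then 6 else 7) := by decide
  have e3 : ∀ x y z, flip3 x y z 8 = (if z then 9 else 8) ∧
    flip3 x y z 9 = (if z then 8 else 9) := by decide
  refine ⟨?_, ?_, ?_, ?_⟩
  · simp [dd, e0]
  · cases x <;> simp [dd, e1]
  · cases y <;> simp [dd, e2]
  · cases z <;> simp [dd, e3]

lemma Gr.glue {s : Fin 10 → Exc} (h : Gr s) :
    ∃ π : Equiv.Perm (Fin 10), Gr (s ∘ π) ∧ Glue (s ∘ π) := by
  obtain ⟨p, q, hp, hq, h1⟩ := h.signs ![0, 1, 2] (by decide)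
  obtain ⟨p', q', hp', hq', h2⟩ := h.signs ![3, 1, 2] (by decide)
  simp only [Matrix.cons_val] at h1 h2
  have horth : p * p' + q * q' = 0 := by
    choose u hu using h1
    choose v hv using h2
    have eu : _root_.dd s 0 + p • _root_.dd s 1 + q • _root_.dd s 2 = (3 : ℤ) • u := by
      ext k; simpa using hu k
    have ev : _root_.dd s 3 + p' • _root_.dd s 1 + q' • _root_.dd s 2 = (3 : ℤ) • v := by
      ext k; simpa using hv k
    have : B (_root_.dd s 0 + p • _root_.dd s 1 + q • _root_.dd s 2)
        (_root_.dd s 3 + p' • _root_.dd s 1 + q' • _root_.dd s 2) = B ((3 : ℤ) • u) ((3 : ℤ) • v) := by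
      rw [eu, ev]
    simp only [B_add_left, B_add_right, B_smul_left, B_smul_right, h.dd] at this
    simp at this
    rcases hp with rfl | rfl <;> rcases hq with rfl | rfl <;> rcases hp' with rfl | rfl <;>
      rcases hq' with rfl | rfl <;> omega
  refine ⟨flip3 (p == -1) (q == -1) (p * p' == -1), h.perm _ (flip3_block _ _ _), ?_⟩
  obtain ⟨f0, f1, f2, f3⟩ := flip3_dd s (p == -1) (q == -1) (p * p' == -1)
  unfold Glue
  rw [f0, f1, f2, f3]
  constructor <;> intro k <;> have h1 := h1 k <;> have h2 := h2 k <;>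
    rcases hp with rfl | rfl <;> rcases hq with rfl | rfl <;> rcases hp' with rfl | rfl <;>
      rcases hq' with rfl | rfl <;> simp at horth h1 h2 ⊢ <;> omega

lemma enum (S : Finset Exc) (hcl : IsClique {1, 2} S)
    (hpat : HasWeight2Graph (fun i j => blockTTEE i = blockTTEE j) S) :
    ∃ s : Fin 10 → Exc, Gr s ∧ Glue s ∧ Finset.univ.image s = S := by
  obtain ⟨σ, hσ⟩ := hpat
  have h : Gr (fun i => (σ i).1) := by
    intro i j
    by_cases hij : i = j
    · subst hij; rw [if_pos rfl]; exact (σ i).1.2.1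
    · have h1 := hσ i j hij
      have h2 := hcl _ (σ i).2 _ (σ j).2 (fun h => hij (σ.injective (Subtype.ext h)))
      simp only [Set.mem_insert_iff, Set.mem_singleton_iff] at h2
      rw [if_neg hij]
      split_ifs with hb
      · exact h1.2 hb
      · exact h2.resolve_right fun h => hb (h1.1 h)
  obtain ⟨π, hg, hgl⟩ := h.glue
  refine ⟨_, hg, hgl, ?_⟩
  ext x
  simp only [Finset.mem_image, Finset.mem_univ, true_and, Function.comp]
  constructor
  · rintro ⟨i, rfl⟩; exact (σ (π i)).2
  · intro hx; exact ⟨π.symm (σ.symm ⟨x, hx⟩), by simp⟩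

/-- `W` acts transitively on the 10-element cliques in `C` with weights in `{1,2}` whose
weight-2 graph is a disjoint union of two triangles and two single edges. -/
theorem stmt4 (S T : Finset Exc)
    (hScard : S.card = 10) (hScl : IsClique {1, 2} S)
    (hSpat : HasWeight2Graph (fun i j => blockTTEE i = blockTTEE j) S)
    (hTcard : T.card = 10) (hTcl : IsClique {1, 2} T)
    (hTpat : HasWeight2Graph (fun i j => blockTTEE i = blockTTEE j) T) :
    SameOrbit S T := by
  obtain ⟨s, hs, gs, hS⟩ := enum S hScl hSpat
  obtain ⟨t, ht, gt, hT⟩ := enum T hTcl hTpat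
  obtain ⟨g, hg, hgs⟩ := orbit_of hs ht gs gt
  refine ⟨g, hg, ?_⟩
  ext x
  rw [← hS, ← hT]
  simp only [Finset.mem_image, Finset.mem_univ, true_and]
  constructor
  · rintro ⟨_, ⟨i, rfl⟩, rfl⟩
    exact ⟨i, (hgs i).symm⟩
  · rintro ⟨i, rfl⟩
    exact ⟨s i, ⟨i, rfl⟩, hgs i⟩
end

section
/- W acts transitively on the set of 10-element cliques in C with weights in {1,2} whose weight-2 graph is a disjoint union of three triangles and one isolated vertex. -/
/-- Block structure of a disjoint union of three triangles (`{0,1,2}`, `{3,4,5}`, `{6,7,8}`)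
and one isolated vertex (`{9}`). -/
def blockTTTV (i : Fin 10) : ℕ :=
  if i.1 < 3 then 0 else if i.1 < 6 then 1 else if i.1 < 9 then 2 else 3


/-! ### Lists of coordinates -/

def toL (v : Fin 9 → ℤ) : List ℤ := [v 0, v 1, v 2, v 3, v 4, v 5, v 6, v 7, v 8]

def dotL : List ℤ → List ℤ → ℤ
  | a :: l, b :: m => a * b + dotL l m
  | _, _ => 0

def BL : List ℤ → List ℤ → ℤ
  | a :: l, b :: m => a * b - dotL l m
  | _, _ => 0

lemma B_eq (v w : Fin 9 → ℤ) : B v w = BL (toL v) (toL w) := by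
  simp [B, BL, toL, dotL, Fin.sum_univ_succ]

lemma toL_inj {v w : Fin 9 → ℤ} (h : toL v = toL w) : v = w := by
  simp only [toL, List.cons.injEq, and_true] at h
  funext i
  fin_cases i <;> simp [h]

lemma toLx_inj {x y : Exc} (h : toL x.1 = toL y.1) : x = y := Subtype.ext (toL_inj h)

/-! ### Enumeration of the exceptional classes -/

def enumL : ℕ → ℤ → ℤ → List (List ℤ)
  | 0, s, q => if s = 0 ∧ q = 0 then [[]] else []
  | n + 1, s, q =>
    if s * s ≤ (n + 1 : ℕ) * q then
      [-1, 0, 1, 2, 3].flatMap fun b => (enumL n (s - b) (q - b * b)).map (List.cons b)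
    else []

lemma cs_list (l : List ℤ) : l.sum * l.sum ≤ (l.length : ℤ) * (dotL l l) := by
  induction l with
  | nil => simp [dotL]
  | cons a l ih =>
    have h : 2 * a * l.sum ≤ (l.length : ℤ) * (a * a) + dotL l l := by
      rcases Nat.eq_zero_or_pos l.length with h0 | h0
      · have : l = [] := List.length_eq_zero_iff.mp h0
        subst this; simp [dotL]
      · have hn : (0 : ℤ) < l.length := by exact_mod_cast h0
        nlinarith [sq_nonneg ((l.length : ℤ) * a - l.sum)]
    simp only [List.sum_cons, List.length_cons, dotL]
    push_cast
    nlinarith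

lemma mem_enumL (l : List ℤ) (hb : ∀ b ∈ l, -1 ≤ b ∧ b ≤ 3) :
    l ∈ enumL l.length l.sum (dotL l l) := by
  induction l with
  | nil => simp [enumL, dotL]
  | cons a l ih =>
    have h := cs_list (a :: l)
    have ih' := ih (fun b hb' => hb b (List.mem_cons_of_mem _ hb'))
    have ha := hb a List.mem_cons_self
    rw [List.length_cons] at h ⊢
    rw [enumL, if_pos h, List.mem_flatMap]
    refine ⟨a, ?_, ?_⟩
    · obtain ⟨h1, h2⟩ := ha
      interval_cases a <;> simp
    · rw [List.mem_map]
      refine ⟨l, ?_, rfl⟩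
      convert ih' using 2
      · simp
      · simp [dotL]

def LL : List (List ℤ) :=
  [0, 1, 2, 3, 4, 5, 6].flatMap fun a => (enumL 8 (3 * a - 1) (a * a + 1)).map (List.cons a)

lemma coord_bound (a b s q : ℤ) (hcs : s * s ≤ 7 * q) (hs : b + s = 3 * a - 1)
    (hq : b * b + q = a * a + 1) : (0 ≤ a ∧ a ≤ 6) ∧ (-1 ≤ b ∧ b ≤ 3) := by
  have hs' : s = 3 * a - 1 - b := by linarith
  have hq' : q = a * a + 1 - b * b := by linarith
  subst hs' hq'
  have h1 : -1 ≤ a := by nlinarith [sq_nonneg (8 * b - 3 * a + 1)]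
  have h2 : a ≤ 7 := by nlinarith [sq_nonneg (8 * b - 3 * a + 1)]
  have h3 : -1 ≤ b := by
    by_contra hc
    have : b ≤ -2 := by omega
    interval_cases a <;> nlinarith
  have h4 : b ≤ 3 := by
    by_contra hc
    have : 4 ≤ b := by omega
    interval_cases a <;> nlinarith
  refine ⟨?_, h3, h4⟩
  interval_cases a <;> interval_cases b <;> omega

lemma mem_LL (x : Exc) : toL x.1 ∈ LL := by
  obtain ⟨v, h1, h2⟩ := x
  have hK : toL Kcl = [-3, -1, -1, -1, -1, -1, -1, -1, -1] := by simp [toL, Kcl]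
  rw [B_eq] at h1 h2
  rw [hK] at h2
  simp only [BL, toL, dotL] at h1 h2
  have key : ∀ (a b : ℤ) (l : List ℤ), l.length = 7 → b + l.sum = 3 * a - 1 →
      b * b + dotL l l = a * a + 1 → (0 ≤ a ∧ a ≤ 6) ∧ (-1 ≤ b ∧ b ≤ 3) := by
    intro a b l hl hs hq
    have := cs_list l
    rw [hl] at this
    exact coord_bound a b _ _ (by exact_mod_cast this) hs hq
  have k1 := key (v 0) (v 1) [v 2, v 3, v 4, v 5, v 6, v 7, v 8] rfl
    (by simp; linarith) (by simp [dotL]; linarith)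
  have k2 := key (v 0) (v 2) [v 1, v 3, v 4, v 5, v 6, v 7, v 8] rfl
    (by simp; linarith) (by simp [dotL]; linarith)
  have k3 := key (v 0) (v 3) [v 1, v 2, v 4, v 5, v 6, v 7, v 8] rfl
    (by simp; linarith) (by simp [dotL]; linarith)
  have k4 := key (v 0) (v 4) [v 1, v 2, v 3, v 5, v 6, v 7, v 8] rfl
    (by simp; linarith) (by simp [dotL]; linarith)
  have k5 := key (v 0) (v 5) [v 1, v 2, v 3, v 4, v 6, v 7, v 8] rfl
    (by simp; linarith) (by simp [dotL]; linarith)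
  have k6 := key (v 0) (v 6) [v 1, v 2, v 3, v 4, v 5, v 7, v 8] rfl
    (by simp; linarith) (by simp [dotL]; linarith)
  have k7 := key (v 0) (v 7) [v 1, v 2, v 3, v 4, v 5, v 6, v 8] rfl
    (by simp; linarith) (by simp [dotL]; linarith)
  have k8 := key (v 0) (v 8) [v 1, v 2, v 3, v 4, v 5, v 6, v 7] rfl
    (by simp; linarith) (by simp [dotL]; linarith)
  have hm := mem_enumL [v 1, v 2, v 3, v 4, v 5, v 6, v 7, v 8]
    (by simpa using ⟨k1.2, k2.2, k3.2, k4.2, k5.2, k6.2, k7.2, k8.2⟩)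
  rw [LL, List.mem_flatMap]
  refine ⟨v 0, ?_, ?_⟩
  · obtain ⟨⟨h3, h4⟩, -⟩ := k1
    generalize v 0 = a at h3 h4 ⊢
    interval_cases a <;> simp
  · rw [List.mem_map]
    refine ⟨_, ?_, rfl⟩
    convert hm using 2
    · simp
    · simp; linarith
    · simp [dotL]; linarith

lemma LL_exc : (LL.all fun l => l.length == 9 && BL l l == -1 &&
    BL l [-3, -1, -1, -1, -1, -1, -1, -1, -1] == -1) = true := by
  decide +kernel

lemma exists_exc {l : List ℤ} (h : l ∈ LL) : ∃ x : Exc, toL x.1 = l := by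
  have h' := List.all_eq_true.mp LL_exc l h
  simp only [Bool.and_eq_true, beq_iff_eq] at h'
  obtain ⟨⟨h1, h2⟩, h3⟩ := h'
  have hl : toL (fun i => l.getD i.1 0) = l := by
    match l, h1 with
    | [_, _, _, _, _, _, _, _, _], _ => rfl
  have hK : toL Kcl = [-3, -1, -1, -1, -1, -1, -1, -1, -1] := by simp [toL, Kcl]
  exact ⟨⟨fun i => l.getD i.1 0, by rw [B_eq, hl]; exact h2, by rw [B_eq, hl, hK]; exact h3⟩, hl⟩

/-! ### Reflections -/

lemma B_add_smul (v w a b : Fin 9 → ℤ) (c d : ℤ) :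
    B (fun i => v i + c * a i) (fun i => w i + d * b i) =
      B v w + d * B v b + c * B w a + c * d * B a b := by
  simp only [B, Fin.sum_univ_succ, Fin.sum_univ_zero]
  ring

def rfn (α v : Fin 9 → ℤ) : Fin 9 → ℤ := fun i => v i + B v α * α i

lemma rfn_B {α : Fin 9 → ℤ} (h : B α α = -2) (v w : Fin 9 → ℤ) :
    B (rfn α v) (rfn α w) = B v w := by
  unfold rfn
  rw [B_add_smul, h]; ring

lemma rfn_fix {α v : Fin 9 → ℤ} (h : B v α = 0) : rfn α v = v := by
  funext i; simp [rfn, h]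

lemma rfn_rfn {α : Fin 9 → ℤ} (h : B α α = -2) (v : Fin 9 → ℤ) : rfn α (rfn α v) = v := by
  have e : B (rfn α v) α = - B v α := by
    have := B_add_smul v α α α (B v α) 0
    simp only [zero_mul, add_zero, mul_zero] at this
    unfold rfn
    rw [this, B_comm α α, h]; ring
  funext i
  have : rfn α (rfn α v) i = rfn α v i + B (rfn α v) α * α i := rfl
  rw [this, e]
  simp [rfn]

lemma rfn_exc {α : Fin 9 → ℤ} (h : B α α = -2) (hK : B α Kcl = 0) {v : Fin 9 → ℤ}
    (hv : IsExc v) : IsExc (rfn α v) := by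
  refine ⟨by rw [rfn_B h]; exact hv.1, ?_⟩
  have : rfn α Kcl = Kcl := rfn_fix (by rw [B_comm]; exact hK)
  rw [← this, rfn_B h]; exact hv.2

def rfl9 (α : Fin 9 → ℤ) (h : B α α = -2) (hK : B α Kcl = 0) : Exc ≃ Exc where
  toFun x := ⟨rfn α x.1, rfn_exc h hK x.2⟩
  invFun x := ⟨rfn α x.1, rfn_exc h hK x.2⟩
  left_inv x := Subtype.ext (rfn_rfn h x.1)
  right_inv x := Subtype.ext (rfn_rfn h x.1)

lemma rfl9_pres (α : Fin 9 → ℤ) (h : B α α = -2) (hK : B α Kcl = 0) :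
    PreservesB (rfl9 α h hK) := fun x y => rfn_B h x.1 y.1

lemma pres_trans {g h : Exc ≃ Exc} (hg : PreservesB g) (hh : PreservesB h) :
    PreservesB (g.trans h) := fun x y => by
  simp only [Equiv.trans_apply]; rw [hh, hg]

lemma pres_symm {g : Exc ≃ Exc} (hg : PreservesB g) : PreservesB g.symm := fun x y => by
  rw [← hg, Equiv.apply_symm_apply, Equiv.apply_symm_apply]

lemma move (Q : Exc → Prop) (x z : Exc) (hQ : ∀ p, Q p → Bx p x = Bx p z)
    (h : x = z ∨ Bx x z = 0) :
    ∃ g : Exc ≃ Exc, PreservesB g ∧ (∀ p, Q p → g p = p) ∧ g x = z := by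
  rcases h with rfl | h
  · exact ⟨Equiv.refl _, fun _ _ => rfl, fun _ _ => rfl, rfl⟩
  · have lin : ∀ v, B v (fun i => x.1 i + (-1) * z.1 i) = B v x.1 - B v z.1 := by
      intro v
      simp only [B, Fin.sum_univ_succ, Fin.sum_univ_zero]
      ring
    have h' : B x.1 z.1 = 0 := h
    have hx := x.2
    have hz := z.2
    have e1 : B (fun i => x.1 i + (-1) * z.1 i) (fun i => x.1 i + (-1) * z.1 i) = -2 := by
      rw [B_add_smul, h', hx.1, hz.1]; norm_num
    have e2 : B (fun i => x.1 i + (-1) * z.1 i) Kcl = 0 := by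
      rw [B_comm, lin, B_comm, hx.2, B_comm, hz.2]; norm_num
    refine ⟨rfl9 _ e1 e2, rfl9_pres _ e1 e2, ?_, ?_⟩
    · intro p hp
      apply Subtype.ext
      apply rfn_fix
      have := hQ p hp
      unfold Bx at this
      rw [lin, this]; ring
    · apply Subtype.ext
      funext i
      have : (rfl9 _ e1 e2 x).1 i =
        x.1 i + B x.1 (fun i => x.1 i + (-1) * z.1 i) * (x.1 i + (-1) * z.1 i) := rfl
      rw [this, lin, h', hx.1]; ring

/-! ### The finite computation -/

def Wt (i j : ℕ) : ℤ := if i / 3 = j / 3 then 2 else 1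

def tgt : List (List (List ℤ)) :=
  let c : List (List ℤ) := [[0, -1, 0, 0, 0, 0, 0, 0, 0], [3, 2, 0, 1, 1, 1, 1, 1, 1],
    [6, 2, 3, 2, 2, 2, 2, 2, 2], [1, 1, 1, 0, 0, 0, 0, 0, 0], [4, 1, 1, 1, 1, 1, 2, 2, 2],
    [4, 1, 1, 2, 2, 2, 1, 1, 1]]
  let a1 : List ℤ := [3, 1, 1, 0, 1, 2, 1, 1, 1]
  let a2 : List ℤ := [3, 1, 1, 1, 2, 0, 1, 1, 1]
  let a3 : List ℤ := [3, 1, 1, 2, 0, 1, 1, 1, 1]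
  let b1 : List ℤ := [3, 1, 1, 1, 1, 1, 0, 1, 2]
  let b2 : List ℤ := [3, 1, 1, 1, 1, 1, 1, 2, 0]
  let b3 : List ℤ := [3, 1, 1, 1, 1, 1, 2, 0, 1]
  [c ++ [a1, a2, a3, b1], c ++ [a1, a3, a2, b1], c ++ [b1, b2, b3, a1], c ++ [b1, b3, b2, a1]]

def near (x z : List ℤ) : Bool := BL x z == 0 || x == z

def condL (T : List (List ℤ)) (k : ℕ) (x : List ℤ) : Bool :=
  (List.range k).all fun i => BL (T.getD i []) x == Wt i k

def XX (T : List (List ℤ)) (k : ℕ) : List (List ℤ) := LL.filter (condL T k)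

def chk (k : ℕ) : Bool :=
  tgt.all fun T => (XX T k).all fun x => tgt.any fun T' =>
    T'.take k == T.take k && (XX T k).contains (T'.getD k []) &&
      (XX T k).any fun z => near x z &&
        (XX T k).any fun w => near w (T'.getD k []) && near z w

lemma chk_all : ∀ k < 10, chk k = true := by
  decide +kernel

lemma red (x : Fin 10 → Exc) (hx : ∀ i j, i ≠ j → Bx (x i) (x j) = Wt i.1 j.1) :
    ∀ k ≤ 10, ∃ T ∈ tgt, ∃ g : Exc ≃ Exc, PreservesB g ∧
      ∀ i : Fin 10, i.1 < k → toL (g (x i)).1 = T.getD i.1 [] := by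
  intro k
  induction k with
  | zero =>
    intro _
    exact ⟨_, List.mem_cons_self, Equiv.refl _, fun _ _ => rfl, fun i hi => absurd hi (by omega)⟩
  | succ k ih =>
    intro hk
    obtain ⟨T, hT, g, hg, hgx⟩ := ih (by omega)
    have hc := chk_all k (by omega)
    let kk : Fin 10 := ⟨k, by omega⟩
    have hmem : toL (g (x kk)).1 ∈ XX T k := by
      unfold XX
      rw [List.mem_filter]
      refine ⟨mem_LL _, ?_⟩
      unfold condL
      rw [List.all_eq_true]
      intro i hi
      rw [List.mem_range] at hi
      rw [beq_iff_eq, ← hgx ⟨i, by omega⟩ hi, ← B_eq]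
      have h1 := hg (x ⟨i, by omega⟩) (x kk)
      rw [hx _ _ (by intro h; have := congrArg Fin.val h; simp [kk] at this; omega)] at h1
      exact h1
    have hXQ : ∀ u : Exc, toL u.1 ∈ XX T k → ∀ i : Fin 10, i.1 < k →
        Bx (g (x i)) u = Wt i.1 k := by
      intro u hu i hi
      unfold XX at hu
      rw [List.mem_filter] at hu
      have h2 := hu.2
      unfold condL at h2
      rw [List.all_eq_true] at h2
      have h3 := h2 i.1 (List.mem_range.mpr hi)
      rw [beq_iff_eq, ← hgx i hi, ← B_eq] at h3
      exact h3
    have hlift : ∀ l ∈ XX T k, ∃ u : Exc, toL u.1 = l := fun l hl =>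
      exists_exc (List.mem_filter.mp hl).1
    have hnear : ∀ u v : Exc, near (toL u.1) (toL v.1) = true → u = v ∨ Bx u v = 0 := by
      intro u v h
      unfold near at h
      rw [Bool.or_eq_true, beq_iff_eq, beq_iff_eq, ← B_eq] at h
      rcases h with h | h
      · exact Or.inr h
      · exact Or.inl (toLx_inj h)
    have hc1 := List.all_eq_true.mp (List.all_eq_true.mp hc T hT) _ hmem
    obtain ⟨T', hT', h1⟩ := List.any_eq_true.mp hc1
    simp only [Bool.and_eq_true, List.any_eq_true, beq_iff_eq, List.contains_iff_mem] at h1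
    obtain ⟨⟨htake, hy⟩, z, hz, hxz, w, hw, hwy, hzw⟩ := h1
    obtain ⟨Y, hY⟩ := hlift _ hy
    obtain ⟨Z, rfl⟩ := hlift _ hz
    obtain ⟨V, rfl⟩ := hlift _ hw
    rw [← hY] at hwy hy
    have mv : ∀ u v : Exc, toL u.1 ∈ XX T k → toL v.1 ∈ XX T k →
        near (toL u.1) (toL v.1) = true → ∃ f : Exc ≃ Exc, PreservesB f ∧
          (∀ p, (∃ i : Fin 10, i.1 < k ∧ p = g (x i)) → f p = p) ∧ f u = v := by
      intro u v hu hv huv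
      apply move _ _ _ _ (hnear u v huv)
      rintro p ⟨i, hi, rfl⟩
      rw [hXQ u hu i hi, hXQ v hv i hi]
    obtain ⟨f1, p1, q1, r1⟩ := mv _ _ hmem hz hxz
    obtain ⟨f2, p2, q2, r2⟩ := mv _ _ hz hw hzw
    obtain ⟨f3, p3, q3, r3⟩ := mv _ _ hw hy hwy
    refine ⟨T', hT', ((g.trans f1).trans f2).trans f3,
      pres_trans (pres_trans (pres_trans hg p1) p2) p3, ?_⟩
    intro i hi
    simp only [Equiv.trans_apply]
    rcases Nat.lt_succ_iff_lt_or_eq.mp hi with h | h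
    · have hp : ∃ j : Fin 10, j.1 < k ∧ g (x i) = g (x j) := ⟨i, h, rfl⟩
      rw [q1 _ hp, q2 _ hp, q3 _ hp, hgx i h]
      have e1 : (T'.take k).getD i.1 [] = T'.getD i.1 [] := by
        simp [List.getD_eq_getElem?_getD, h]
      have e2 : (T.take k).getD i.1 [] = T.getD i.1 [] := by
        simp [List.getD_eq_getElem?_getD, h]
      rw [← e1, ← e2, htake]
    · have : i = kk := Fin.ext h
      subst this
      rw [r1, r2, r3, hY]

def rfL (al l : List ℤ) : List ℤ := List.zipWith (fun p q => p + BL l al * q) l al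

lemma toL_rfn (α v : Fin 9 → ℤ) : toL (rfn α v) = rfL (toL α) (toL v) := by
  have : ∀ i, rfn α v i = v i + BL (toL v) (toL α) * α i := fun i => by
    rw [← B_eq]; rfl
  conv_lhs => unfold toL
  simp only [this]
  rfl

lemma exists_refl (l : List ℤ) (h1 : l.length = 9) (h2 : BL l l = -2)
    (h3 : BL l [-3, -1, -1, -1, -1, -1, -1, -1, -1] = 0) :
    ∃ g : Exc ≃ Exc, PreservesB g ∧ ∀ x, toL (g x).1 = rfL l (toL x.1) := by
  have hl : toL (fun i => l.getD i.1 0) = l := by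
    match l, h1 with
    | [_, _, _, _, _, _, _, _, _], _ => rfl
  have hK : toL Kcl = [-3, -1, -1, -1, -1, -1, -1, -1, -1] := by simp [toL, Kcl]
  refine ⟨rfl9 (fun i => l.getD i.1 0) (by rw [B_eq, hl]; exact h2)
    (by rw [B_eq, hl, hK]; exact h3), rfl9_pres _ _ _, fun x => ?_⟩
  conv_rhs => rw [← hl]
  exact toL_rfn _ _

def T0 : List (List ℤ) := tgt.getD 0 []

lemma exists_fix : ∀ T ∈ tgt, ∃ (g : Exc ≃ Exc) (f : List ℤ → List ℤ), PreservesB g ∧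
    (∀ x, toL (g x).1 = f (toL x.1)) ∧
    (∀ i : Fin 10, f (T.getD i.1 []) ∈ T0) ∧ (∀ l ∈ T0, ∃ i : Fin 10, l = f (T.getD i.1 [])) := by
  obtain ⟨g1, p1, q1⟩ := exists_refl [-2, -1, -1, -1, -1, 0, 0, -1, -1]
    (by decide) (by decide) (by decide)
  obtain ⟨g2, p2, q2⟩ := exists_refl [-2, -1, -1, 0, -1, -1, -1, -1, 0]
    (by decide) (by decide) (by decide)
  obtain ⟨g3, p3, q3⟩ := exists_refl [-2, -1, -1, -1, 0, -1, -1, 0, -1]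
    (by decide) (by decide) (by decide)
  have hA : ∀ T ∈ tgt.take 2, (∀ i : Fin 10, T.getD i.1 [] ∈ T0) ∧
      (∀ l ∈ T0, ∃ i : Fin 10, l = T.getD i.1 []) := by decide +kernel
  have hB : ∀ T ∈ tgt.drop 2, (∀ i : Fin 10, rfL [-2, -1, -1, -1, 0, -1, -1, 0, -1]
        (rfL [-2, -1, -1, 0, -1, -1, -1, -1, 0]
          (rfL [-2, -1, -1, -1, -1, 0, 0, -1, -1] (T.getD i.1 []))) ∈ T0) ∧
      (∀ l ∈ T0, ∃ i : Fin 10, l = rfL [-2, -1, -1, -1, 0, -1, -1, 0, -1]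
        (rfL [-2, -1, -1, 0, -1, -1, -1, -1, 0]
          (rfL [-2, -1, -1, -1, -1, 0, 0, -1, -1] (T.getD i.1 [])))) := by decide +kernel
  intro T hT
  rw [← List.take_append_drop 2 tgt, List.mem_append] at hT
  rcases hT with hT | hT
  · exact ⟨Equiv.refl _, id, fun _ _ => rfl, fun _ => rfl, (hA T hT).1, (hA T hT).2⟩
  · refine ⟨(g1.trans g2).trans g3, fun l => rfL [-2, -1, -1, -1, 0, -1, -1, 0, -1]
        (rfL [-2, -1, -1, 0, -1, -1, -1, -1, 0]
          (rfL [-2, -1, -1, -1, -1, 0, 0, -1, -1] l)), pres_trans (pres_trans p1 p2) p3, ?_,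
      (hB T hT).1, (hB T hT).2⟩
    intro x
    simp only [Equiv.trans_apply, q1, q2, q3]

lemma blk_eq : ∀ i j : Fin 10, blockTTTV i = blockTTTV j ↔ i.1 / 3 = j.1 / 3 := by decide

lemma canon (S : Finset Exc) (hcl : IsClique {1, 2} S)
    (hpat : HasWeight2Graph (fun i j => blockTTTV i = blockTTTV j) S) :
    ∃ g : Exc ≃ Exc, PreservesB g ∧ ∀ y, y ∈ S.image g ↔ toL y.1 ∈ T0 := by
  obtain ⟨σ, hσ⟩ := hpat
  have hx : ∀ i j, i ≠ j → Bx (σ i).1 (σ j).1 = Wt i.1 j.1 := by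
    intro i j hij
    have h1 := hσ i j hij
    have h2 := hcl _ (σ i).2 _ (σ j).2 (fun h => hij (σ.injective (Subtype.ext h)))
    simp only [blk_eq] at h1
    unfold Wt
    split_ifs with h
    · exact h1.mpr h
    · rcases h2 with h2 | h2
      · exact h2
      · exact absurd (h1.mp h2) h
  obtain ⟨T, hT, g, hg, hgx⟩ := red (fun i => (σ i).1) hx 10 le_rfl
  obtain ⟨h, f, hh, hf, hf1, hf2⟩ := exists_fix T hT
  have key : ∀ i, toL (h (g (σ i).1)).1 = f (T.getD i.1 []) := fun i => by
    rw [hf, hgx i i.2]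
  refine ⟨g.trans h, pres_trans hg hh, fun y => ?_⟩
  rw [Finset.mem_image]
  constructor
  · rintro ⟨s, hs, rfl⟩
    obtain ⟨i, hi⟩ := σ.surjective ⟨s, hs⟩
    have := key i
    rw [hi] at this
    rw [Equiv.trans_apply, this]
    exact hf1 i
  · intro hy
    obtain ⟨i, hi⟩ := hf2 _ hy
    refine ⟨(σ i).1, (σ i).2, toLx_inj ?_⟩
    rw [hi, Equiv.trans_apply, key]

/-- `W` acts transitively on the 10-element cliques in `C` with weights in `{1,2}` whose
weight-2 graph is a disjoint union of three triangles and one isolated vertex. -/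
theorem stmt5 (S T : Finset Exc)
    (hScard : S.card = 10) (hScl : IsClique {1, 2} S)
    (hSpat : HasWeight2Graph (fun i j => blockTTTV i = blockTTTV j) S)
    (hTcard : T.card = 10) (hTcl : IsClique {1, 2} T)
    (hTpat : HasWeight2Graph (fun i j => blockTTTV i = blockTTTV j) T) :
    SameOrbit S T := by
  obtain ⟨g, hg, hgS⟩ := canon S hScl hSpat
  obtain ⟨h, hh, hhT⟩ := canon T hTcl hTpat
  refine ⟨g.trans h.symm, pres_trans hg (pres_symm hh), ?_⟩
  have e : S.image g = T.image h := by
    ext y; rw [hgS, hhT]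
  ext y
  have e2 : h y ∈ S.image g ↔ h y ∈ T.image h := by rw [e]
  simp only [Finset.mem_image, Equiv.trans_apply, EmbeddingLike.apply_eq_iff_eq,
    exists_eq_right] at e2 ⊢
  rw [← e2]
  simp only [Equiv.symm_apply_eq]
end
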